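/- Let k be an even positive integer and j a nonnegative integer. Then ∫_ℝ χ_{2j+1}^k(u) · sign(cos(π u)) du = F_k · (2j+1)^{−k}, where χ_{2j+1}^k is the k-fold convolution over ℝ of the function χ_{2j+1} with itself, F_k = (2/π)^k 𝒦_k, and 𝒦_k = (4/π) Σ_{m∈ℤ} (4m+1)^{−(k+1)}. -/

import Mathlib

open Real MeasureTheory

noncomputable section
open scoped Classical

/-- The normalized indicator `χ_a : ℝ → ℝ`, equal to `a⁻¹` on `(-a/2, a/2)`
and `0` elsewhere. -/
def chiR (a : ℝ) (x : ℝ) : ℝ := if |x| < a / 2 then a⁻¹ else 0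

/-- Convolution over `ℝ`: `(f*g)(x) = ∫_ℝ f(u) g(x-u) du`. -/
def rconv (f g : ℝ → ℝ) (x : ℝ) : ℝ := ∫ u, f u * g (x - u)

/-- The `k`-fold self-convolution of `χ_a` over `ℝ`: `χ_a^1 = χ_a`,
`χ_a^{k+1} = χ_a * χ_a^k`. -/
def chiRK (a : ℝ) : ℕ → ℝ → ℝ
  | 0 => fun _ => 0
  | 1 => chiR a
  | (k + 2) => rconv (chiR a) (chiRK a (k + 1))

/-- The `k`-th Favard constant `𝒦_k = (4/π) ∑_{j ∈ ℤ} (4j+1)^{-(k+1)}`. -/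
def favard (k : ℕ) : ℝ := (4 / π) * ∑' j : ℤ, 1 / (4 * (j : ℝ) + 1) ^ (k + 1)

/-- `F_k = (2/π)^k 𝒦_k`. -/
def Fconst (k : ℕ) : ℝ := (2 / π) ^ k * favard k


lemma chiR_mul_eq_indicator (a : ℝ) (f : ℝ → ℝ) :
    (fun v => chiR a v * f v) =
      (Set.Ioo (-(a / 2)) (a / 2)).indicator (fun v => a⁻¹ * f v) := by
  funext v
  by_cases h : |v| < a / 2
  · simp [chiR, h, Set.indicator, abs_lt.1 h]
  · have h' : v ∉ Set.Ioo (-(a / 2)) (a / 2) := fun hv => h (abs_lt.2 hv)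
    rw [Set.indicator_of_notMem h']
    simp [chiR, h]

lemma integrable_chiR (a : ℝ) : Integrable (chiR a) := by
  have h := chiR_mul_eq_indicator a (fun _ => 1)
  simp only [mul_one] at h
  rw [show chiR a = fun v => chiR a v from rfl, h]
  refine (integrable_indicator_iff measurableSet_Ioo).2 ?_
  exact integrableOn_const (by simp)

lemma integral_chiR_mul {a : ℝ} (ha : 0 < a) (f : ℝ → ℝ) (w : ℝ) :
    ∫ v, chiR a v * f (v + w) = a⁻¹ * ∫ x in (w - a / 2)..(w + a / 2), f x := by
  rw [chiR_mul_eq_indicator a (fun v => f (v + w)), integral_indicator measurableSet_Ioo,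
    integral_const_mul, ← integral_Ioc_eq_integral_Ioo,
    ← intervalIntegral.integral_of_le (by linarith),
    intervalIntegral.integral_comp_add_right (fun x => f x)]
  congr 2 <;> ring

/-- Integrating a convolution against a bounded function `f` amounts to integrating one factor
against the correlation of `f` with the other. -/
lemma integral_rconv_mul {φ ψ f : ℝ → ℝ} (hφ : Integrable φ) (hψ : Integrable ψ)
    (hf : Measurable f) {C : ℝ} (hC : ∀ x, ‖f x‖ ≤ C) :
    ∫ u, rconv φ ψ u * f u = ∫ w, ψ w * ∫ v, φ v * f (v + w) := by
  have h₁ : Integrable (fun p : ℝ × ℝ => φ p.2 * ψ (p.1 - p.2) * f p.1)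
      (volume.prod volume) :=
    (hφ.convolution_integrand (ContinuousLinearMap.mul ℝ ℝ) hψ).mul_bdd
      (hf.comp measurable_fst).aestronglyMeasurable (Filter.Eventually.of_forall fun p => hC p.1)
  have h₂ : Integrable (fun p : ℝ × ℝ => φ p.1 * ψ p.2 * f (p.1 + p.2))
      (volume.prod volume) :=
    (hφ.mul_prod hψ).mul_bdd (hf.comp (measurable_fst.add measurable_snd)).aestronglyMeasurable
      (Filter.Eventually.of_forall fun p => hC _)
  calc ∫ u, rconv φ ψ u * f u = ∫ u, ∫ v, φ v * ψ (u - v) * f u := by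
        simp only [rconv, integral_mul_const]
    _ = ∫ v, ∫ u, φ v * ψ (u - v) * f u := integral_integral_swap h₁
    _ = ∫ v, ∫ w, φ v * ψ w * f (v + w) := by
        congr 1; funext v
        rw [← integral_add_right_eq_self (fun u => φ v * ψ (u - v) * f u) v]
        simp [add_comm]
    _ = ∫ w, ∫ v, φ v * ψ w * f (v + w) := integral_integral_swap h₂
    _ = _ := by
        congr 1; funext w
        rw [← integral_const_mul]
        congr 1; funext v; ring

lemma integrable_chiRK (a : ℝ) (k : ℕ) : Integrable (chiRK a (k + 1)) := by
  induction k with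
  | zero => exact integrable_chiR a
  | succ k ih =>
    exact (integrable_chiR a).integrable_convolution (ContinuousLinearMap.mul ℝ ℝ) ih

/-- The recursion `χ_a^{k+1} = χ_a * χ_a^k`, tested against a bounded function. -/
lemma integral_chiRK_add_two_mul {a : ℝ} (ha : 0 < a) (k : ℕ) {f : ℝ → ℝ} (hf : Measurable f)
    {C : ℝ} (hC : ∀ x, ‖f x‖ ≤ C) :
    ∫ u, chiRK a (k + 2) u * f u =
      ∫ w, chiRK a (k + 1) w * (a⁻¹ * ∫ x in (w - a / 2)..(w + a / 2), f x) := by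
  simp only [← integral_chiR_mul ha]
  exact integral_rconv_mul (integrable_chiR a) (integrable_chiRK a k) hf hC

lemma inv_mul_integral_cos {a ω : ℝ} (hω : ω ≠ 0) (w : ℝ) :
    a⁻¹ * ∫ x in (w - a / 2)..(w + a / 2), cos (ω * x)
      = 2 * sin (ω * a / 2) / (a * ω) * cos (ω * w) := by
  rw [intervalIntegral.integral_comp_mul_left (fun x => cos x) hω, integral_cos, mul_add, mul_sub,
    sin_add, sin_sub, smul_eq_mul, mul_div_assoc]
  field_simp
  ring

/-- The Fourier transform of `χ_a^{k+1}`. -/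
lemma integral_chiRK_mul_cos {a ω : ℝ} (ha : 0 < a) (hω : ω ≠ 0) (k : ℕ) :
    ∫ u, chiRK a (k + 1) u * cos (ω * u) = (2 * sin (ω * a / 2) / (a * ω)) ^ (k + 1) := by
  induction k with
  | zero =>
    have h := integral_chiR_mul ha (fun x => cos (ω * x)) 0
    rw [inv_mul_integral_cos hω] at h
    simpa [chiRK] using h
  | succ k ih =>
    rw [integral_chiRK_add_two_mul ha k (f := fun u => cos (ω * u)) (by fun_prop)
      (fun x => abs_cos_le_one _)]
    simp only [inv_mul_integral_cos hω]
    rw [pow_succ, ← ih, ← integral_mul_const]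
    congr 1; funext u; ring

lemma hasSum_cos_odd_of_mem_Icc {z : ℝ} (hz : z ∈ Set.Icc 0 π) :
    HasSum (fun m : ℕ => cos ((2 * m + 1) * z) / (2 * m + 1) ^ 2) (π * (π - 2 * z) / 8) := by
  have hπ := pi_pos
  have hall := hasSum_one_div_nat_pow_mul_cos one_ne_zero (x := z / (2 * π))
    ⟨div_nonneg hz.1 (by positivity), (div_le_one (by positivity)).2 (by linarith [hz.2])⟩
  have heven := hasSum_one_div_nat_pow_mul_cos one_ne_zero (x := z / π)
    ⟨div_nonneg hz.1 hπ.le, (div_le_one hπ).2 hz.2⟩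
  have hB (x : ℝ) : (Polynomial.map (algebraMap ℚ ℝ) (Polynomial.bernoulli (2 * 1))).eval x
      = x ^ 2 - x + 6⁻¹ := bernoulliFun_two x
  rw [hB] at hall heven
  have hodd : Summable fun m : ℕ =>
      1 / ((2 * m + 1 : ℕ) : ℝ) ^ (2 * 1) * cos (2 * π * (2 * m + 1 : ℕ) * (z / (2 * π))) :=
    hall.summable.comp_injective (i := fun m : ℕ => 2 * m + 1) fun m n h => by simpa using h
  have heven' : HasSum (fun m : ℕ =>
      1 / ((2 * m : ℕ) : ℝ) ^ (2 * 1) * cos (2 * π * (2 * m : ℕ) * (z / (2 * π))))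
      (π ^ 2 * ((z / π) ^ 2 - z / π + 6⁻¹) / 4) := by
    convert! heven.mul_left (1 / 4) using 1
    swap
    · norm_num; ring
    funext m
    rw [show 2 * π * (2 * m : ℕ) * (z / (2 * π)) = 2 * π * m * (z / π) by
      push_cast; field_simp]
    push_cast
    rw [mul_pow, ← mul_assoc, one_div_mul_one_div]
    norm_num
  have hsum := (heven'.even_add_odd
    (f := fun n : ℕ => 1 / (n : ℝ) ^ (2 * 1) * cos (2 * π * n * (z / (2 * π)))) hodd.hasSum).unique
    hall
  convert! hodd.hasSum using 1
  · funext m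
    rw [show 2 * π * (2 * m + 1 : ℕ) * (z / (2 * π)) = (2 * m + 1) * z by
      push_cast; field_simp]
    push_cast
    ring
  · rw [← eq_sub_iff_add_eq'] at hsum
    rw [hsum]
    norm_num
    field_simp
    ring

/-- The Fourier series of the triangle wave. -/
lemma hasSum_cos_odd (z : ℝ) :
    HasSum (fun m : ℕ => cos ((2 * m + 1) * z) / (2 * m + 1) ^ 2)
      (π / 4 * arcsin (cos z)) := by
  convert! hasSum_cos_odd_of_mem_Icc ⟨arccos_nonneg (cos z), arccos_le_pi (cos z)⟩ using 1
  · funext m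
    have h (y : ℝ) := Polynomial.Chebyshev.T_real_cos y (2 * (m : ℤ) + 1)
    push_cast at h
    rw [← h, ← h, cos_arccos (neg_one_le_cos z) (cos_le_one z)]
  · rw [arccos]; ring

lemma measurable_sign_cos : Measurable fun u : ℝ => Real.sign (cos (π * u)) := by
  unfold Real.sign
  exact Measurable.ite (measurableSet_lt (by fun_prop) measurable_const) measurable_const
    (Measurable.ite (measurableSet_lt measurable_const (by fun_prop)) measurable_const
      measurable_const)

lemma norm_sign_le_one (x : ℝ) : ‖Real.sign x‖ ≤ 1 := by
  rcases Real.sign_apply_eq x with h | h | h <;> simp [h]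

lemma hasDerivAt_arcsin_sin {x : ℝ} (hx : cos x ≠ 0) :
    HasDerivAt (fun y => arcsin (sin y)) (Real.sign (cos x)) x := by
  have hs : 0 < 1 - sin x ^ 2 := by
    rw [← cos_sq']
    positivity
  have h := (hasDerivAt_arcsin (x := sin x) (by rintro h; norm_num [h] at hs)
    (by rintro h; norm_num [h] at hs)).comp x (hasDerivAt_sin x)
  convert! h using 1
  rw [← cos_sq', sqrt_sq_eq_abs]
  rcases lt_or_gt_of_ne hx with h | h
  · rw [Real.sign_of_neg h, abs_of_neg h]; field_simp
  · rw [Real.sign_of_pos h, abs_of_pos h]; field_simp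

lemma integral_sign_cos (b c : ℝ) :
    ∫ x in b..c, Real.sign (cos (π * x))
      = arcsin (sin (π * c)) / π - arcsin (sin (π * b)) / π := by
  have hπ := pi_ne_zero
  refine integral_eq_of_hasDerivAt_off_countable (fun x => arcsin (sin (π * x)) / π) _
    (s := {x | cos (π * x) = 0}) ?_ ?_ ?_ ?_
  · refine (Set.countable_range fun n : ℤ => (2 * (n : ℝ) + 1) / 2).mono ?_
    intro x hx
    obtain ⟨n, hn⟩ := cos_eq_zero_iff.1 (Set.mem_ofPred.1 hx)
    refine ⟨n, ?_⟩
    simp only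
    field_simp at hn ⊢
    linarith
  · exact Continuous.continuousOn (by fun_prop)
  · intro x hx
    have h := ((hasDerivAt_arcsin_sin hx.2).comp x ((hasDerivAt_id x).const_mul π)).div_const π
    convert! h using 1
    field_simp
  · exact (intervalIntegrable_const (c := (1 : ℝ))).mono_fun
      measurable_sign_cos.aestronglyMeasurable
      (Filter.Eventually.of_forall fun x => by simpa using norm_sign_le_one _)

lemma cos_odd_mul_add_nat_mul_pi (m j : ℕ) (x : ℝ) :
    cos ((2 * m + 1) * (x + j * π)) = (-1) ^ j * cos ((2 * m + 1) * x) := by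
  rw [show (2 * m + 1) * (x + j * π) = (2 * m + 1) * x + ((2 * m + 1) * j : ℕ) * π by
    push_cast; ring, cos_add_nat_mul_pi, pow_mul, Odd.neg_one_pow ⟨m, rfl⟩]

lemma cos_odd_mul_sub_nat_mul_pi (m j : ℕ) (x : ℝ) :
    cos ((2 * m + 1) * (x - j * π)) = (-1) ^ j * cos ((2 * m + 1) * x) := by
  rw [show (2 * m + 1) * (x - j * π) = (2 * m + 1) * x - ((2 * m + 1) * j : ℕ) * π by
    push_cast; ring, cos_sub_nat_mul_pi, pow_mul, Odd.neg_one_pow ⟨m, rfl⟩]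

/-- The Fourier series of the square wave averaged over an interval of odd length. -/
lemma hasSum_integral_sign_cos (j : ℕ) (w : ℝ) :
    HasSum (fun m : ℕ => 8 / π ^ 2 * (-1) ^ j / (2 * m + 1) ^ 2 * cos ((2 * m + 1) * π * w))
      (∫ x in (w - (2 * (j : ℝ) + 1) / 2)..(w + (2 * (j : ℝ) + 1) / 2),
        Real.sign (cos (π * x))) := by
  rw [integral_sign_cos]
  have h₁ := hasSum_cos_odd (π * w + j * π)
  have h₂ := hasSum_cos_odd (π * w - (j + 1 : ℕ) * π)
  convert! (h₁.sub h₂).mul_left (4 / π ^ 2) using 1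
  · funext m
    rw [cos_odd_mul_add_nat_mul_pi, cos_odd_mul_sub_nat_mul_pi, pow_succ]
    rw [mul_assoc _ π w]
    ring
  · rw [← cos_sub_pi_div_two, ← cos_sub_pi_div_two]
    rw [show π * (w + (2 * (j : ℝ) + 1) / 2) - π / 2 = π * w + j * π by ring,
      show π * (w - (2 * (j : ℝ) + 1) / 2) - π / 2 = π * w - (j + 1 : ℕ) * π by
        push_cast; ring]
    field_simp

lemma sin_odd_mul_odd_mul_pi_div_two (m j : ℕ) :
    sin ((2 * m + 1) * π * (2 * j + 1) / 2) = (-1) ^ (m + j) := by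
  rw [← cos_sub_pi_div_two,
    show (2 * m + 1) * π * (2 * j + 1) / 2 - π / 2 = ((2 * m * j + (m + j) : ℕ) : ℝ) * π by
      push_cast; ring,
    cos_nat_mul_pi, pow_add, Even.neg_one_pow ⟨m * j, by ring⟩, one_mul]

lemma summable_one_div_odd_pow {n : ℕ} (hn : 1 < n) :
    Summable fun m : ℕ => 1 / (2 * (m : ℝ) + 1) ^ n := by
  have h := (Real.summable_one_div_nat_pow.2 hn).comp_injective
    (i := fun m : ℕ => 2 * m + 1) fun m n h => by simpa using h
  simpa [Function.comp_def] using h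

lemma tsum_int_eq_tsum_nat {n : ℕ} (hn : 1 < n) (ho : Odd n) :
    ∑' j : ℤ, 1 / (4 * (j : ℝ) + 1) ^ n = ∑' m : ℕ, (-1) ^ m / (2 * (m : ℝ) + 1) ^ n := by
  have hs : Summable fun m : ℕ => (-1 : ℝ) ^ m / (2 * (m : ℝ) + 1) ^ n := by
    refine (summable_one_div_odd_pow hn).of_norm_bounded fun m => ?_
    rw [norm_div, norm_pow, norm_neg, norm_one, one_pow, Real.norm_of_nonneg (by positivity)]
  have he : Summable fun i : ℕ => (-1 : ℝ) ^ (2 * i) / (2 * ((2 * i : ℕ) : ℝ) + 1) ^ n :=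
    hs.comp_injective (i := fun m : ℕ => 2 * m) fun m n h => by simpa using h
  have hd : Summable fun i : ℕ =>
      (-1 : ℝ) ^ (2 * i + 1) / (2 * ((2 * i + 1 : ℕ) : ℝ) + 1) ^ n :=
    hs.comp_injective (i := fun m : ℕ => 2 * m + 1) fun m n h => by simpa using h
  have h₁ (i : ℕ) : 1 / (4 * (((i : ℕ) : ℤ) : ℝ) + 1) ^ n
      = (-1 : ℝ) ^ (2 * i) / (2 * ((2 * i : ℕ) : ℝ) + 1) ^ n := by
    rw [pow_mul]; push_cast; norm_num; ring
  have h₂ (i : ℕ) : 1 / (4 * ((-((i : ℤ) + 1) : ℤ) : ℝ) + 1) ^ n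
      = (-1 : ℝ) ^ (2 * i + 1) / (2 * ((2 * i + 1 : ℕ) : ℝ) + 1) ^ n := by
    rw [pow_succ, pow_mul]; push_cast
    rw [show 4 * (-((i : ℝ) + 1)) + 1 = -(2 * (2 * (i : ℝ) + 1) + 1) by ring, ho.neg_pow]
    norm_num [div_neg, neg_div]
  rw [tsum_of_nat_of_neg_add_one (f := fun j : ℤ => 1 / (4 * (j : ℝ) + 1) ^ n)
    (he.congr fun i => (h₁ i).symm) (hd.congr fun i => (h₂ i).symm),
    ← tsum_even_add_odd (f := fun m : ℕ => (-1 : ℝ) ^ m / (2 * (m : ℝ) + 1) ^ n) he hd,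
    tsum_congr h₁, tsum_congr h₂]

theorem integral_Bspline_sign_cos_even (k : ℕ) (hk : Even k) (hk0 : 0 < k) (j : ℕ) :
    ∫ u : ℝ, chiRK (2 * (j : ℝ) + 1) k u * Real.sign (Real.cos (π * u))
      = Fconst k / (2 * (j : ℝ) + 1) ^ k := by
  obtain ⟨n, rfl⟩ : ∃ n, k = n + 2 := by
    obtain ⟨r, rfl⟩ := hk
    exact ⟨r + r - 2, by omega⟩
  have hn : Even n := by simpa [Nat.even_add] using hk
  have ha : (0 : ℝ) < 2 * (j : ℝ) + 1 := by positivity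
  set a : ℝ := 2 * (j : ℝ) + 1 with ha_def
  rw [integral_chiRK_add_two_mul ha n measurable_sign_cos (fun _ => norm_sign_le_one _)]
  set c : ℕ → ℝ := fun m => a⁻¹ * (8 / π ^ 2 * (-1) ^ j / (2 * m + 1) ^ 2) with hc
  have hχ := integrable_chiRK a n
  have hseries (w : ℝ) : HasSum (fun m : ℕ => c m * (chiRK a (n + 1) w * cos ((2 * m + 1) * π * w)))
      (chiRK a (n + 1) w * (a⁻¹ * ∫ x in (w - a / 2)..(w + a / 2), Real.sign (cos (π * x)))) := by
    convert! ((hasSum_integral_sign_cos j w).mul_left a⁻¹).mul_left (chiRK a (n + 1) w) using 1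
    funext m
    simp only [hc]; ring
  have hint (m : ℕ) : Integrable fun w => chiRK a (n + 1) w * cos ((2 * m + 1) * π * w) :=
    hχ.mul_bdd (c := 1) (Continuous.aestronglyMeasurable (by fun_prop))
      (Filter.Eventually.of_forall fun x => abs_cos_le_one _)
  have hbound : Summable fun m : ℕ =>
      ∫ w, ‖c m * (chiRK a (n + 1) w * cos ((2 * m + 1) * π * w))‖ := by
    refine Summable.of_nonneg_of_le (fun m => integral_nonneg fun w => norm_nonneg _)
      (fun m => ?_) ((summable_one_div_odd_pow one_lt_two).mul_left
        (a⁻¹ * (8 / π ^ 2) * ∫ w, ‖chiRK a (n + 1) w‖))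
    have hcm : ‖c m‖ = a⁻¹ * (8 / π ^ 2) * (1 / (2 * (m : ℝ) + 1) ^ 2) := by
      simp only [hc, norm_mul, norm_div, norm_pow, norm_neg, norm_one, one_pow, norm_inv]
      rw [Real.norm_of_nonneg ha.le, Real.norm_of_nonneg pi_pos.le,
        Real.norm_of_nonneg (by positivity : (0 : ℝ) ≤ 2 * m + 1)]
      norm_num
      ring
    simp only [norm_mul (c m), integral_const_mul]
    rw [hcm]
    have : ∫ w, ‖chiRK a (n + 1) w * cos ((2 * m + 1) * π * w)‖ ≤ ∫ w, ‖chiRK a (n + 1) w‖ := by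
      refine integral_mono (hint m).norm hχ.norm fun w => ?_
      simp only [norm_mul]
      exact mul_le_of_le_one_right (norm_nonneg _) (abs_cos_le_one _)
    calc _ ≤ a⁻¹ * (8 / π ^ 2) * (1 / (2 * (m : ℝ) + 1) ^ 2) * ∫ w, ‖chiRK a (n + 1) w‖ := by
          gcongr
      _ = _ := by ring
  have hsum := (hasSum_integral_of_summable_integral_norm
    (fun m => (hint m).const_mul (c m)) hbound).tsum_eq
  simp only [(hseries _).tsum_eq] at hsum
  rw [← hsum, Fconst, favard, tsum_int_eq_tsum_nat (by omega) hk.add_one, ← tsum_mul_left,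
    ← tsum_mul_left, ← tsum_div_const]
  congr 1; funext m
  have hm : (2 * (m : ℝ) + 1) ≠ 0 := by positivity
  have hπ := pi_ne_zero
  rw [integral_const_mul, integral_chiRK_mul_cos ha (by positivity), ha_def,
    sin_odd_mul_odd_mul_pi_div_two, ← ha_def]
  simp only [hc]
  have hsign : (-1 : ℝ) ^ j * ((-1) ^ (m + j)) ^ (n + 1) = (-1) ^ m := by
    rw [← pow_mul, mul_add, mul_one, pow_add _ ((m + j) * n), (hn.mul_left _).neg_one_pow, one_mul,
      pow_add, mul_left_comm, ← pow_add, Even.neg_one_pow ⟨j, rfl⟩, mul_one]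
  rw [← hsign]
  simp only [div_pow, mul_pow]
  field_simp
  ring
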